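/- Under the AOD algorithm with horizon T (losses valued in [0,1], convex, G-Lipschitz gradients, domain diameter at most D), let u_1,…,u_T ∈ Ω be any comparator sequence with path-length P_T = Σ_{t=1}^{T−1} ‖u_{t+1}−u_t‖₂, and suppose D·2^{i−1} < P_T ≤ D·2^{i} for some integer i with 1 ≤ i ≤ ⌈log₂ T⌉. Then Σ_{t=1}^T f_t(w_t) − Σ_{t=1}^T f_t(u_t) ≤ ( DG/2 + (3G/2)·√(2·D·P_T) + √( 3·c(T)·(1 + 2P_T/D) ) )·√T, where c(T) = 1 + ln T + ln(1 + log₂ T) + ln( (5 + 3 ln(1+T))/2 ). -/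

import Mathlib

/-- The AdaNormalHedge potential `Φ(R,C) = exp([R]₊²/(3C))` (with `Φ(R,0) = 1`,
matching `Φ(0,0) = 1`, since `x/0 = 0` in Lean). -/
noncomputable def anhPot (R C : ℝ) : ℝ := Real.exp (max R 0 ^ 2 / (3 * C))

/-- The AdaNormalHedge weight function `w(R,C) = (Φ(R+1,C+1) − Φ(R−1,C+1))/2`. -/
noncomputable def anhW (R C : ℝ) : ℝ := (anhPot (R + 1) (C + 1) - anhPot (R - 1) (C + 1)) / 2

/-- The starting round `(i−1)·2^k + 1` of the interval of the dense geometric covering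
level `D_k` that contains round `t ≥ 1`. -/
def dgcStart (k t : ℕ) : ℕ := (t - 1) / 2 ^ k * 2 ^ k + 1

/-- The levels `k` with `2^k ≤ T` of the dense geometric covering collection
`D = ∪_{k ≥ 0, 2^k ≤ T} D_k`, `D_k = {[(i−1)·2^k + 1, i·2^k] : i ≥ 1}`.  At every round
exactly one interval of each level is active, so experts are indexed by levels. -/
def dgcLevels (T : ℕ) : Finset ℕ := (Finset.range (T + 1)).filter fun k => 2 ^ k ≤ T

/-- `R_{t−1,I} = Σ_{u=min I}^{t−1} (f_u(w_u) − f_u(w_{u,I}))` for the active level-`k`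
expert at round `t` (whose interval starts at `dgcStart k t`); `x k u` is the action of
the level-`k` expert at round `u`. -/
noncomputable def aodMetaR {α : Type*} (f : ℕ → α → ℝ) (w : ℕ → α) (x : ℕ → ℕ → α)
    (k t : ℕ) : ℝ :=
  ∑ u ∈ Finset.Icc (dgcStart k t) (t - 1), (f u (w u) - f u (x k u))

/-- `C_{t−1,I} = Σ_{u=min I}^{t−1} |f_u(w_u) − f_u(w_{u,I})|` for the active level-`k`
expert at round `t`. -/
noncomputable def aodMetaC {α : Type*} (f : ℕ → α → ℝ) (w : ℕ → α) (x : ℕ → ℕ → α)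
    (k t : ℕ) : ℝ :=
  ∑ u ∈ Finset.Icc (dgcStart k t) (t - 1), |f u (w u) - f u (x k u)|

/-- The AdaNormalHedge weight `p_{t,I}` that AOD assigns to the active level-`k`
expert at round `t`. -/
noncomputable def aodWeight {α : Type*} (T : ℕ) (f : ℕ → α → ℝ) (w : ℕ → α)
    (x : ℕ → ℕ → α) (k t : ℕ) : ℝ :=
  anhW (aodMetaR f w x k t) (aodMetaC f w x k t) /
    ∑ k' ∈ dgcLevels T, anhW (aodMetaR f w x k' t) (aodMetaC f w x k' t)

/-- `c(t) = 1 + ln t + ln(1 + log₂ T) + ln((5 + 3 ln(1+t))/2)`. -/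
noncomputable def cAOD (T t : ℕ) : ℝ :=
  1 + Real.log t + Real.log (1 + Real.logb 2 T) + Real.log ((5 + 3 * Real.log (1 + (t : ℝ))) / 2)

theorem sq_add_div_add_le {a b c d : ℝ} (hc : 0 ≤ c) (hd : 0 < d) (ha : c = 0 → a = 0) :
    (a + b) ^ 2 / (c + d) ≤ a ^ 2 / c + b ^ 2 / d := by
  rcases hc.eq_or_lt with rfl | hc
  · simp [ha rfl]
  · rw [div_add_div _ _ hc.ne' hd.ne', div_le_div_iff₀ (by positivity) (by positivity)]
    nlinarith [sq_nonneg (a * d - b * c)]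

/-- Convexity of the potential in `(R, C)` jointly, on the cone where it is not degenerate. -/
theorem anhPot_convex_comb {R C R' C' s : ℝ} (hRC : R ≤ C) (hC : 0 ≤ C) (hC' : 0 < C')
    (hs0 : 0 ≤ s) (hs1 : s ≤ 1) :
    anhPot ((1 - s) * R + s * R') ((1 - s) * C + s * C')
      ≤ (1 - s) * anhPot R C + s * anhPot R' C' := by
  rcases hs0.eq_or_lt with rfl | hs
  · simp
  have hs1' : 0 ≤ 1 - s := by linarith
  have hmax : max ((1 - s) * R + s * R') 0 ≤ (1 - s) * max R 0 + s * max R' 0 :=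
    max_le (by gcongr <;> exact le_max_left _ _) (by positivity)
  have key : max ((1 - s) * R + s * R') 0 ^ 2 / (3 * ((1 - s) * C + s * C'))
      ≤ (1 - s) * (max R 0 ^ 2 / (3 * C)) + s * (max R' 0 ^ 2 / (3 * C')) := by
    calc _ ≤ ((1 - s) * max R 0 + s * max R' 0) ^ 2 / ((1 - s) * (3 * C) + s * (3 * C')) := by
          rw [show 3 * ((1 - s) * C + s * C') = (1 - s) * (3 * C) + s * (3 * C') by ring]
          gcongr
      _ ≤ ((1 - s) * max R 0) ^ 2 / ((1 - s) * (3 * C)) + (s * max R' 0) ^ 2 / (s * (3 * C')) := by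
          refine sq_add_div_add_le (by positivity) (by positivity) fun h => ?_
          rcases mul_eq_zero.1 h with h | h
          · simp [h]
          · rw [max_eq_right (by linarith), mul_zero]
      _ = _ := by
          congr 1
          · rcases hs1'.eq_or_lt with h | h
            · simp [← h]
            · rcases hC.eq_or_lt with h' | h'
              · simp [← h']
              · field_simp
          · field_simp
  refine (Real.exp_le_exp.2 key).trans ?_
  have := convexOn_exp.2 (Set.mem_univ (max R 0 ^ 2 / (3 * C)))
    (Set.mem_univ (max R' 0 ^ 2 / (3 * C'))) hs1' hs0 (by ring)
  simpa [anhPot] using this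

theorem one_le_anhPot {R C : ℝ} (hC : 0 ≤ C) : 1 ≤ anhPot R C :=
  Real.one_le_exp (by positivity)

theorem anhPot_zero_left (C : ℝ) : anhPot 0 C = 1 := by simp [anhPot]

/-- The mean of the two unit moves exceeds the current potential by at most a constant. -/
theorem anhPot_unit_moves_le {R C : ℝ} (hRC : R ≤ C) (hC : 0 ≤ C) :
    (anhPot (R + 1) (C + 1) + anhPot (R - 1) (C + 1)) / 2 ≤ anhPot R C + 4 := by
  have h1 := one_le_anhPot (R := R) hC
  rcases le_total R 0 with hR | hR
  · have e1 : anhPot (R + 1) (C + 1) ≤ Real.exp 1 := by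
      refine Real.exp_le_exp.2 ?_
      rw [div_le_one (by positivity)]
      have : max (R + 1) 0 ≤ 1 := max_le (by linarith) zero_le_one
      nlinarith [le_max_right (R + 1) 0]
    have e2 : anhPot (R - 1) (C + 1) = 1 := by
      simp [anhPot, max_eq_right (show R - 1 ≤ 0 by linarith)]
    linarith [Real.exp_one_lt_d9]
  have hC1 : 0 < C + 1 := by positivity
  obtain ⟨a, ha⟩ : ∃ a, a = 1 / (3 * (C + 1)) := ⟨_, rfl⟩
  have ha0 : 0 < a := ha ▸ by positivity
  have haC : a * (3 * (C + 1)) = 1 := by rw [ha]; field_simp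
  have hplus : anhPot (R + 1) (C + 1) = Real.exp (a * (R + 1) ^ 2) := by
    rw [anhPot, max_eq_left (by linarith), ha]
    congr 1
    ring
  have hminus : anhPot (R - 1) (C + 1) ≤ Real.exp (a * (R - 1) ^ 2) := by
    refine Real.exp_le_exp.2 ?_
    rw [div_eq_mul_one_div, ← ha, mul_comm]
    refine mul_le_mul_of_nonneg_left ?_ ha0.le
    rcases max_cases (R - 1) 0 with ⟨h, _⟩ | ⟨h, _⟩ <;> rw [h]
    nlinarith [sq_nonneg (R - 1)]
  have hmean : (anhPot (R + 1) (C + 1) + anhPot (R - 1) (C + 1)) / 2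
      ≤ Real.exp (a * R ^ 2 + a + 2 * a ^ 2 * R ^ 2) := by
    calc _ ≤ (Real.exp (a * (R + 1) ^ 2) + Real.exp (a * (R - 1) ^ 2)) / 2 := by
          rw [hplus]; gcongr
      _ = Real.exp (a * R ^ 2 + a) * Real.cosh (2 * a * R) := by
          rw [Real.cosh_eq, mul_div_assoc', mul_add, ← Real.exp_add, ← Real.exp_add]
          ring_nf
      _ ≤ Real.exp (a * R ^ 2 + a) * Real.exp ((2 * a * R) ^ 2 / 2) := by
          gcongr
          exact Real.cosh_le_exp_half_sq _
      _ = _ := by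
          rw [← Real.exp_add]
          ring_nf
  refine hmean.trans ?_
  by_cases hcase : 3 * C * (C + 1) ≤ R ^ 2 * (C + 3) ∧ 0 < C
  · obtain ⟨hcase, hCpos⟩ := hcase
    have : Real.exp (a * R ^ 2 + a + 2 * a ^ 2 * R ^ 2) ≤ anhPot R C := by
      refine Real.exp_le_exp.2 ?_
      rw [max_eq_left hR, ha, ← sub_nonneg]
      have : R ^ 2 / (3 * C) - (1 / (3 * (C + 1)) * R ^ 2 + 1 / (3 * (C + 1))
          + 2 * (1 / (3 * (C + 1))) ^ 2 * R ^ 2)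
          = (R ^ 2 * (C + 3) - 3 * C * (C + 1)) / (9 * C * (C + 1) ^ 2) := by
        field_simp
        ring
      rw [this]
      exact div_nonneg (by linarith) (by positivity)
    linarith
  · have hsmall : R ^ 2 ≤ 3 * C := by
      by_cases hCpos : 0 < C
      · have h : R ^ 2 * (C + 3) < 3 * C * (C + 1) := not_le.1 fun h => hcase ⟨h, hCpos⟩
        nlinarith
      · nlinarith
    have haR : a * R ^ 2 + a ≤ 1 := by nlinarith
    have haR2 : 2 * a ^ 2 * R ^ 2 ≤ 1 / 2 := by
      have h1 : a ^ 2 * R ^ 2 ≤ a ^ 2 * (3 * C) := by gcongr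
      have h2 : a * (3 * C) = 1 - 3 * a := by linarith
      have h3 : a ^ 2 * (3 * C) = a * (1 - 3 * a) := by rw [← h2]; ring
      nlinarith [sq_nonneg (6 * a - 1)]
    have h5 : Real.exp (a * R ^ 2 + a + 2 * a ^ 2 * R ^ 2) ≤ 5 := by
      calc _ ≤ Real.exp (3 / 2) := Real.exp_le_exp.2 (by linarith)
        _ ≤ 5 := by
          refine le_of_sq_le_sq ?_ (by norm_num)
          rw [← Real.exp_nat_mul, show ((2 : ℕ) : ℝ) * (3 / 2) = ((3 : ℕ) : ℝ) * 1 by norm_num,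
            Real.exp_nat_mul]
          calc Real.exp 1 ^ 3 ≤ 2.7182818286 ^ 3 := by
                gcongr
                exact Real.exp_one_lt_d9.le
            _ ≤ _ := by norm_num
    linarith

/-- One-step growth of the potential. -/
theorem anhPot_add_le {R C r : ℝ} (hRC : R ≤ C) (hC : 0 ≤ C) (hr : |r| ≤ 1) :
    anhPot (R + r) (C + |r|) ≤ anhPot R C + anhW R C * r + 4 := by
  have hmean := anhPot_unit_moves_le hRC hC
  have hr0 := abs_nonneg r
  have hC1 : 0 < C + 1 := by positivity
  have main : anhPot (R + r) (C + |r|) ≤ anhPot R C + anhW R C * r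
      + |r| * ((anhPot (R + 1) (C + 1) + anhPot (R - 1) (C + 1)) / 2 - anhPot R C) := by
    rcases abs_cases r with ⟨h, _⟩ | ⟨h, _⟩ <;> rw [h] at hr hr0 ⊢
    · have := anhPot_convex_comb (R' := R + 1) hRC hC hC1 hr0 hr
      rw [show (1 - r) * R + r * (R + 1) = R + r by ring,
        show (1 - r) * C + r * (C + 1) = C + r by ring] at this
      refine this.trans_eq ?_
      rw [anhW]
      ring
    · have := anhPot_convex_comb (R' := R - 1) hRC hC hC1 hr0 hr
      rw [show (1 - -r) * R + -r * (R - 1) = R + r by ring,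
        show (1 - -r) * C + -r * (C + 1) = C + -r by ring] at this
      refine this.trans_eq ?_
      rw [anhW]
      ring
  nlinarith

theorem anhW_nonneg {R C : ℝ} (hC : 0 ≤ C) : 0 ≤ anhW R C := by
  have h : anhPot (R - 1) (C + 1) ≤ anhPot (R + 1) (C + 1) := by
    refine Real.exp_le_exp.2 ?_
    gcongr
    linarith
  rw [anhW]
  linarith

theorem anhW_zero_pos : 0 < anhW 0 0 := by
  norm_num [anhW, anhPot]

theorem le_sqrt_of_anhPot_le {R C c : ℝ} (hRC : R ≤ C) (hC : 0 ≤ C)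
    (h : anhPot R C ≤ Real.exp c) : R ≤ Real.sqrt (3 * c * C) := by
  rcases hC.eq_or_lt with rfl | hC
  · simpa using hRC
  refine Real.le_sqrt_of_sq_le ?_ |>.trans' (le_max_left R 0)
  have := Real.exp_le_exp.1 h
  rw [div_le_iff₀ (by positivity)] at this
  linarith

theorem one_le_dgcStart (k t : ℕ) : 1 ≤ dgcStart k t := Nat.le_add_left _ _

theorem dgcStart_le {k t : ℕ} (ht : 1 ≤ t) : dgcStart k t ≤ t := by
  have := Nat.div_mul_le_self (t - 1) (2 ^ k)
  unfold dgcStart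
  omega

theorem dgcStart_one (k : ℕ) : dgcStart k 1 = 1 := by simp [dgcStart]

theorem dgcStart_zero {t : ℕ} (ht : 1 ≤ t) : dgcStart 0 t = t := by
  simp only [dgcStart, pow_zero, Nat.div_one, mul_one]
  omega

theorem dgcStart_succ (k : ℕ) {t : ℕ} (ht : 1 ≤ t) :
    dgcStart k (t + 1) = dgcStart k t ∨ dgcStart k (t + 1) = t + 1 := by
  obtain ⟨s, rfl⟩ : ∃ s, t = s + 1 := ⟨t - 1, by omega⟩
  simp only [dgcStart, Nat.add_sub_cancel]
  by_cases h : 2 ^ k ∣ s + 1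
  · right
    rw [Nat.div_mul_cancel h]
  · left
    rw [Nat.succ_div_of_not_dvd h]

theorem dgcStart_eq {k j t : ℕ} (h1 : j * 2 ^ k < t) (h2 : t ≤ (j + 1) * 2 ^ k) :
    dgcStart k t = j * 2 ^ k + 1 := by
  rw [dgcStart, Nat.div_eq_of_lt_le (k := j) (by omega) (by omega)]

theorem card_dgcLevels_le (T : ℕ) :
    ((dgcLevels T).card : ℝ) ≤ 1 + Real.logb 2 T := by
  have hsub : dgcLevels T ⊆ Finset.range (Nat.log 2 T + 1) := by
    intro k hk
    rw [Finset.mem_range, Nat.lt_succ_iff]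
    exact Nat.le_log_of_pow_le one_lt_two (Finset.mem_filter.1 hk).2
  have h1 : ((dgcLevels T).card : ℝ) ≤ Nat.log 2 T + 1 := by
    exact_mod_cast (Finset.card_le_card hsub).trans_eq (Finset.card_range _)
  have h2 : (Nat.log 2 T : ℝ) ≤ Real.logb 2 T := by exact_mod_cast Real.natLog_le_logb T 2
  linarith

theorem card_dgcLevels_mul_le_exp_cAOD {T : ℕ} (hT : 1 ≤ T) :
    5 * ((dgcLevels T).card : ℝ) * T ≤ Real.exp (cAOD T T) := by
  have hT' : (1 : ℝ) ≤ T := by exact_mod_cast hT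
  have hlogb : 0 ≤ Real.logb 2 T := Real.logb_nonneg one_lt_two hT'
  have hlog : 0 ≤ Real.log (1 + (T : ℝ)) := Real.log_nonneg (by linarith)
  have hc : Real.exp (cAOD T T) = Real.exp 1 * T * (1 + Real.logb 2 T)
      * ((5 + 3 * Real.log (1 + (T : ℝ))) / 2) := by
    rw [cAOD, Real.exp_add, Real.exp_add, Real.exp_add, Real.exp_log (by linarith),
      Real.exp_log (by linarith), Real.exp_log (by linarith)]
  have he : (2 : ℝ) ≤ Real.exp 1 := by linarith [Real.add_one_le_exp (1 : ℝ)]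
  calc 5 * ((dgcLevels T).card : ℝ) * T ≤ 5 * (1 + Real.logb 2 T) * T := by
        gcongr
        exact card_dgcLevels_le T
    _ = 2 * T * (1 + Real.logb 2 T) * (5 / 2) := by ring
    _ ≤ _ := by
        rw [hc]
        gcongr
        linarith

theorem cAOD_nonneg {T : ℕ} (hT : 1 ≤ T) : 0 ≤ cAOD T T := by
  have hT' : (1 : ℝ) ≤ T := by exact_mod_cast hT
  have hlogb : 0 ≤ Real.logb 2 T := Real.logb_nonneg one_lt_two hT'
  have hlog : 0 ≤ Real.log (1 + (T : ℝ)) := Real.log_nonneg (by linarith)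
  have h1 := Real.log_nonneg hT'
  have h2 : 0 ≤ Real.log (1 + Real.logb 2 T) := Real.log_nonneg (by linarith)
  have h3 : 0 ≤ Real.log ((5 + 3 * Real.log (1 + (T : ℝ))) / 2) :=
    Real.log_nonneg (by linarith)
  rw [cAOD]
  linarith

theorem sum_le_sum_abs_self (s : Finset ℕ) (a : ℕ → ℝ) : ∑ u ∈ s, a u ≤ ∑ u ∈ s, |a u| :=
  Finset.sum_le_sum fun _ _ => le_abs_self _

/-- Growth of the total AdaNormalHedge potential over the active intervals. -/
theorem sum_anhPot_le (K : Finset ℕ) (r : ℕ → ℕ → ℝ) (hr : ∀ k t, 1 ≤ t → |r k t| ≤ 1)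
    (hw : ∀ t, 1 ≤ t → ∑ k ∈ K, anhW (∑ u ∈ Finset.Icc (dgcStart k t) (t - 1), r k u)
      (∑ u ∈ Finset.Icc (dgcStart k t) (t - 1), |r k u|) * r k t ≤ 0) :
    ∀ t, 1 ≤ t → ∑ k ∈ K, anhPot (∑ u ∈ Finset.Icc (dgcStart k t) t, r k u)
      (∑ u ∈ Finset.Icc (dgcStart k t) t, |r k u|) ≤ 5 * (K.card : ℝ) * t := by
  have step : ∀ t, 1 ≤ t → ∑ k ∈ K, anhPot (∑ u ∈ Finset.Icc (dgcStart k t) t, r k u)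
      (∑ u ∈ Finset.Icc (dgcStart k t) t, |r k u|)
      ≤ ∑ k ∈ K, anhPot (∑ u ∈ Finset.Icc (dgcStart k t) (t - 1), r k u)
        (∑ u ∈ Finset.Icc (dgcStart k t) (t - 1), |r k u|) + 4 * (K.card : ℝ) := by
    intro t ht
    have hsplit : ∀ (k : ℕ) (a : ℕ → ℝ), ∑ u ∈ Finset.Icc (dgcStart k t) t, a u
        = ∑ u ∈ Finset.Icc (dgcStart k t) (t - 1), a u + a t := by
      intro k a
      obtain ⟨s, rfl⟩ : ∃ s, t = s + 1 := ⟨t - 1, by omega⟩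
      rw [Finset.sum_Icc_succ_top (dgcStart_le ht), Nat.add_sub_cancel]
    calc _ ≤ ∑ k ∈ K, (anhPot (∑ u ∈ Finset.Icc (dgcStart k t) (t - 1), r k u)
        (∑ u ∈ Finset.Icc (dgcStart k t) (t - 1), |r k u|)
        + anhW (∑ u ∈ Finset.Icc (dgcStart k t) (t - 1), r k u)
          (∑ u ∈ Finset.Icc (dgcStart k t) (t - 1), |r k u|) * r k t + 4) := by
          refine Finset.sum_le_sum fun k _ => ?_
          rw [hsplit, hsplit]
          exact anhPot_add_le (sum_le_sum_abs_self _ _)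
            (Finset.sum_nonneg fun _ _ => abs_nonneg _) (hr k t ht)
      _ ≤ _ := by
          rw [Finset.sum_add_distrib, Finset.sum_add_distrib, Finset.sum_const, nsmul_eq_mul]
          linarith [hw t ht]
  intro t ht
  induction t, ht using Nat.le_induction with
  | base =>
    refine (step 1 le_rfl).trans_eq ?_
    simp only [dgcStart_one, Nat.sub_self, Finset.Icc_eq_empty_of_lt one_pos, Finset.sum_empty,
      anhPot_zero_left, Finset.sum_const, nsmul_eq_mul, Nat.cast_one]
    ring
  | succ t ht ih =>
    have hstart : ∑ k ∈ K, anhPot (∑ u ∈ Finset.Icc (dgcStart k (t + 1)) t, r k u)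
        (∑ u ∈ Finset.Icc (dgcStart k (t + 1)) t, |r k u|)
        ≤ ∑ k ∈ K, anhPot (∑ u ∈ Finset.Icc (dgcStart k t) t, r k u)
          (∑ u ∈ Finset.Icc (dgcStart k t) t, |r k u|) := by
      refine Finset.sum_le_sum fun k _ => ?_
      rcases dgcStart_succ k ht with h | h <;> rw [h]
      rw [Finset.Icc_eq_empty_of_lt (Nat.lt_succ_self t), Finset.sum_empty, Finset.sum_empty,
        anhPot_zero_left]
      exact one_le_anhPot (Finset.sum_nonneg fun _ _ => abs_nonneg _)
    have := step (t + 1) (by omega)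
    rw [Nat.add_sub_cancel] at this
    push_cast
    have hcard : (0 : ℝ) ≤ K.card := by positivity
    linarith

/-- Square-root bounds on the blocks of one level add up by Cauchy-Schwarz. -/
theorem sum_le_of_block_bounds {k T : ℕ} {a : ℕ → ℝ} {A : ℝ} (hA : 0 ≤ A)
    (hblock : ∀ t, 1 ≤ t → t ≤ T → ∑ u ∈ Finset.Icc (dgcStart k t) t, a u
      ≤ A * Real.sqrt ((t : ℝ) - dgcStart k t + 1)) (j : ℕ) :
    ∀ t, j * 2 ^ k < t → t ≤ (j + 1) * 2 ^ k → t ≤ T →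
      ∑ u ∈ Finset.Icc 1 t, a u ≤ A * Real.sqrt (((j : ℝ) + 1) * t) := by
  induction j with
  | zero =>
    intro t h1 h2 hT
    have h := hblock t (by omega) hT
    rw [dgcStart_eq h1 h2] at h
    simpa using h
  | succ j ih =>
    intro t h1 h2 hT
    have hpos : 0 < 2 ^ k := by positivity
    have hlast := hblock t (by omega) hT
    rw [dgcStart_eq h1 h2] at hlast
    have hprev := ih ((j + 1) * 2 ^ k) (by nlinarith) le_rfl (by omega)
    have hsplit : ∑ u ∈ Finset.Icc 1 t, a u = ∑ u ∈ Finset.Icc 1 ((j + 1) * 2 ^ k), a u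
        + ∑ u ∈ Finset.Icc ((j + 1) * 2 ^ k + 1) t, a u := by
      have := Finset.sum_Ioc_consecutive a (Nat.zero_le ((j + 1) * 2 ^ k)) h1.le
      simpa [← Finset.Icc_add_one_left_eq_Ioc] using this.symm
    rw [hsplit]
    set s := (j + 1) * 2 ^ k with hs
    have hst : (s : ℝ) ≤ t := by exact_mod_cast h1.le
    have hlen : (t : ℝ) - ((s + 1 : ℕ) : ℝ) + 1 = t - s := by push_cast; ring
    rw [hlen] at hlast
    refine (add_le_add hprev hlast).trans ?_
    rw [← mul_add]
    refine mul_le_mul_of_nonneg_left ?_ hA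
    refine Real.le_sqrt_of_sq_le ?_
    push_cast
    set x := Real.sqrt (((j : ℝ) + 1) * s)
    set y := Real.sqrt ((t : ℝ) - s)
    have hx : x ^ 2 = ((j : ℝ) + 1) * s := Real.sq_sqrt (by positivity)
    have hy : y ^ 2 = (t : ℝ) - s := Real.sq_sqrt (by linarith)
    have hsx : (s : ℝ) = x ^ 2 / (j + 1) := by rw [hx]; field_simp
    have hxy : 2 * x * y ≤ s + (j + 1) * y ^ 2 := by
      have : s + (j + 1) * y ^ 2 - 2 * x * y = (x - (j + 1) * y) ^ 2 / (j + 1) := by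
        rw [hsx]; field_simp; ring
      have h0 : 0 ≤ (x - (j + 1) * y) ^ 2 / (j + 1) := by positivity
      linarith
    have : (x + y) ^ 2 = x ^ 2 + y ^ 2 + 2 * x * y := by ring
    rw [this]
    nlinarith

section OnlineGradientDescent

variable {E : Type*} [NormedAddCommGroup E] [InnerProductSpace ℝ E]

theorem norm_proj_sub_sq_le {Ω : Set E} (hconv : Convex ℝ Ω) {z p v : E} (hp : p ∈ Ω)
    (hmin : ∀ z' ∈ Ω, ‖p - z‖ ≤ ‖z' - z‖) (hv : v ∈ Ω) : ‖p - v‖ ^ 2 ≤ ‖z - v‖ ^ 2 := by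
  have hinf : ‖z - p‖ = ⨅ q : Ω, ‖z - q‖ := by
    have : Nonempty Ω := ⟨⟨p, hp⟩⟩
    refine le_antisymm (le_ciInf fun q => ?_) ?_
    · rw [norm_sub_rev z p, norm_sub_rev z q]
      exact hmin q q.2
    · exact ciInf_le ⟨0, fun _ ⟨_, h⟩ => h ▸ norm_nonneg _⟩ (⟨p, hp⟩ : Ω)
  have hinner := (norm_eq_iInf_iff_real_inner_le_zero hconv hp).1 hinf v hv
  have hexp : ‖z - v‖ ^ 2 = ‖z - p‖ ^ 2 + 2 * inner ℝ (z - p) (p - v) + ‖p - v‖ ^ 2 := by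
    rw [← norm_add_sq_real, sub_add_sub_cancel]
  have hneg : inner ℝ (z - p) (p - v) = -inner ℝ (z - p) (v - p) := by
    rw [← inner_neg_right, neg_sub]
  nlinarith [sq_nonneg ‖z - p‖]

theorem sub_le_inner_gradient [CompleteSpace E] {f : E → ℝ} (hf : ConvexOn ℝ Set.univ f) {z : E}
    (hd : DifferentiableAt ℝ f z) (v : E) : f z - f v ≤ inner ℝ (gradient f z) (z - v) := by
  have hline : ConvexOn ℝ Set.univ (f ∘ AffineMap.lineMap (k := ℝ) z v) := by
    simpa using hf.comp_affineMap (AffineMap.lineMap (k := ℝ) z v)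
  have hder : HasDerivAt (f ∘ AffineMap.lineMap (k := ℝ) z v)
      (inner ℝ (gradient f z) (v - z)) 0 := by
    have h1 : HasFDerivAt f (InnerProductSpace.toDual ℝ E (gradient f z))
        (AffineMap.lineMap z v (0 : ℝ)) := by
      simpa using hd.hasGradientAt.hasFDerivAt
    simpa using h1.comp_hasDerivAt (0 : ℝ) AffineMap.hasDerivAt_lineMap
  have := hline.le_slope_of_hasDerivAt (Set.mem_univ 0) (Set.mem_univ 1) zero_lt_one hder
  simp only [slope, sub_zero, inv_one, Function.comp_apply, AffineMap.lineMap_apply_one,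
    AffineMap.lineMap_apply_zero, vsub_eq_sub, one_smul] at this
  have hneg : inner ℝ (gradient f z) (z - v) = -inner ℝ (gradient f z) (v - z) := by
    rw [← inner_neg_right, neg_sub]
  linarith

/-- Dynamic regret of projected online gradient descent with step size `η`. -/
theorem ogd_dynamic_regret [CompleteSpace E] {T : ℕ} {D G η : ℝ} {Ω : Set E}
    (hconv : Convex ℝ Ω) (hdiam : ∀ z ∈ Ω, ∀ z' ∈ Ω, ‖z - z'‖ ≤ D) {f : ℕ → E → ℝ}
    (hfconv : ∀ t, ConvexOn ℝ Set.univ (f t)) (hfdiff : ∀ t z, DifferentiableAt ℝ (f t) z)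
    (hgrad : ∀ t, ∀ z ∈ Ω, ‖gradient (f t) z‖ ≤ G) {proj : E → E}
    (hproj : ∀ z, proj z ∈ Ω ∧ ∀ z' ∈ Ω, ‖proj z - z‖ ≤ ‖z' - z‖) {x : ℕ → E}
    (hx : ∀ t, 1 ≤ t → x t ∈ Ω)
    (hxup : ∀ t, 1 ≤ t → x (t + 1) = proj (x t - η • gradient (f t) (x t))) (hη : 0 ≤ η)
    {u : ℕ → E} (hu : ∀ t, 1 ≤ t → t ≤ T → u t ∈ Ω) (n : ℕ) (hn : 1 ≤ n) (hnT : n ≤ T) :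
    2 * η * ∑ t ∈ Finset.Icc 1 n, (f t (x t) - f t (u t))
      ≤ D ^ 2 - ‖x (n + 1) - u n‖ ^ 2 + n * (η ^ 2 * G ^ 2)
        + 2 * D * ∑ t ∈ Finset.Ico 1 n, ‖u (t + 1) - u t‖ := by
  have step : ∀ t, 1 ≤ t → t ≤ T → 2 * η * (f t (x t) - f t (u t))
      ≤ ‖x t - u t‖ ^ 2 - ‖x (t + 1) - u t‖ ^ 2 + η ^ 2 * G ^ 2 := by
    intro t ht htT
    have hp := hproj (x t - η • gradient (f t) (x t))
    have h1 := norm_proj_sub_sq_le hconv hp.1 hp.2 (hu t ht htT)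
    rw [← hxup t ht, sub_right_comm, norm_sub_sq_real (x t - u t), inner_smul_right, norm_smul, mul_pow,
      real_inner_comm, Real.norm_eq_abs, sq_abs] at h1
    have h2 := sub_le_inner_gradient (hfconv t) (hfdiff t (x t)) (u t)
    have h3 : η ^ 2 * ‖gradient (f t) (x t)‖ ^ 2 ≤ η ^ 2 * G ^ 2 := by
      gcongr
      exact hgrad t _ (hx t ht)
    have h4 := mul_le_mul_of_nonneg_left h2 (by positivity : 0 ≤ 2 * η)
    linarith
  induction n, hn using Nat.le_induction with
  | base =>
    have h := step 1 le_rfl hnT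
    have hD : ‖x 1 - u 1‖ ^ 2 ≤ D ^ 2 := by
      gcongr
      exact hdiam _ (hx 1 le_rfl) _ (hu 1 le_rfl hnT)
    simp only [Finset.Icc_self, Finset.sum_singleton, Nat.cast_one, Finset.Ico_self,
      Finset.sum_empty]
    linarith
  | succ n hn ih =>
    have h := step (n + 1) (by omega) hnT
    have ih := ih (by omega)
    rw [Finset.sum_Icc_succ_top (by omega), Finset.sum_Ico_succ_top hn]
    have hx' := hx (n + 1) (by omega)
    have ha := hdiam _ hx' _ (hu (n + 1) (by omega) hnT)
    have hb := hdiam _ hx' _ (hu n hn (by omega))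
    have htri : ‖x (n + 1) - u (n + 1)‖ ≤ ‖x (n + 1) - u n‖ + ‖u (n + 1) - u n‖ := by
      rw [norm_sub_rev (u (n + 1))]
      exact norm_sub_le_norm_sub_add_norm_sub ..
    have hmove : ‖x (n + 1) - u (n + 1)‖ ^ 2
        ≤ ‖x (n + 1) - u n‖ ^ 2 + 2 * D * ‖u (n + 1) - u n‖ := by
      have h0 := norm_nonneg (x (n + 1) - u (n + 1))
      have h1 := norm_nonneg (x (n + 1) - u n)
      have h2 := norm_nonneg (u (n + 1) - u n)
      nlinarith
    push_cast
    linarith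

end OnlineGradientDescent

/-- Regret of AOD on `[1, T]` against the level-`k` expert, from AdaNormalHedge on each block. -/
theorem aod_regret_against_level {E : Type*} [AddCommGroup E] [Module ℝ E] {T : ℕ} (hT : 1 ≤ T)
    {Ω : Set E} (hconv : Convex ℝ Ω) {f : ℕ → E → ℝ}
    (hfconv : ∀ t, ConvexOn ℝ Ω (f t))
    (hrange : ∀ t, ∀ z ∈ Ω, 0 ≤ f t z ∧ f t z ≤ 1) {x : ℕ → ℕ → E}
    (hx : ∀ k t, 1 ≤ t → x k t ∈ Ω) {w : ℕ → E}
    (hw : ∀ t, 1 ≤ t → w t = ∑ k ∈ dgcLevels T, aodWeight T f w x k t • x k t)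
    {k : ℕ} (hk : 2 ^ k ≤ T) :
    ∑ t ∈ Finset.Icc 1 T, (f t (w t) - f t (x k t))
      ≤ Real.sqrt (3 * cAOD T T) * Real.sqrt ((1 + T / 2 ^ k) * T) := by
  have hmem : ∀ k, k ∈ dgcLevels T ↔ 2 ^ k ≤ T := fun k => by
    simp only [dgcLevels, Finset.mem_filter, Finset.mem_range, and_iff_right_iff_imp]
    exact fun h => (Nat.lt_two_pow_self.trans_le h).trans (Nat.lt_succ_self T)
  have hC : ∀ k t, 0 ≤ aodMetaC f w x k t := fun k t =>
    Finset.sum_nonneg fun _ _ => abs_nonneg _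
  have hW : ∀ k t, 0 ≤ anhW (aodMetaR f w x k t) (aodMetaC f w x k t) := fun k t =>
    anhW_nonneg (hC k t)
  have hsum : ∀ t, 1 ≤ t →
      0 < ∑ k ∈ dgcLevels T, anhW (aodMetaR f w x k t) (aodMetaC f w x k t) := by
    intro t ht
    refine Finset.sum_pos' (fun k _ => hW k t) ⟨0, (hmem 0).2 (by simpa using hT), ?_⟩
    rw [aodMetaR, aodMetaC, dgcStart_zero ht, Finset.Icc_eq_empty_of_lt (by omega)]
    simpa using anhW_zero_pos
  have hp0 : ∀ k t, 0 ≤ aodWeight T f w x k t := fun k t =>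
    div_nonneg (hW k t) (Finset.sum_nonneg fun k _ => hW k t)
  have hp1 : ∀ t, 1 ≤ t → ∑ k ∈ dgcLevels T, aodWeight T f w x k t = 1 := by
    intro t ht
    simp only [aodWeight]
    rw [← Finset.sum_div, div_self (hsum t ht).ne']
  have hwΩ : ∀ t, 1 ≤ t → w t ∈ Ω := by
    intro t ht
    rw [hw t ht]
    exact hconv.sum_mem (fun k _ => hp0 k t) (hp1 t ht) fun k _ => hx k t ht
  have hr : ∀ k t, 1 ≤ t → |f t (w t) - f t (x k t)| ≤ 1 := by
    intro k t ht
    have h1 := hrange t _ (hwΩ t ht)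
    have h2 := hrange t _ (hx k t ht)
    exact abs_le.2 ⟨by linarith, by linarith⟩
  have hjensen : ∀ t, 1 ≤ t → ∑ k ∈ dgcLevels T, anhW (aodMetaR f w x k t) (aodMetaC f w x k t)
      * (f t (w t) - f t (x k t)) ≤ 0 := by
    intro t ht
    have hJ : f t (w t) ≤ ∑ k ∈ dgcLevels T, aodWeight T f w x k t * f t (x k t) := by
      conv_lhs => rw [hw t ht]
      exact (hfconv t).map_sum_le (fun k _ => hp0 k t) (hp1 t ht) fun k _ => hx k t ht
    have hscale : ∑ k ∈ dgcLevels T, anhW (aodMetaR f w x k t) (aodMetaC f w x k t)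
        * f t (x k t) = (∑ k ∈ dgcLevels T, anhW (aodMetaR f w x k t) (aodMetaC f w x k t))
          * ∑ k ∈ dgcLevels T, aodWeight T f w x k t * f t (x k t) := by
      rw [Finset.mul_sum]
      refine Finset.sum_congr rfl fun k _ => ?_
      rw [aodWeight, ← mul_assoc, mul_div_cancel₀ _ (hsum t ht).ne']
    simp only [mul_sub]
    rw [Finset.sum_sub_distrib, ← Finset.sum_mul, hscale, sub_nonpos]
    exact mul_le_mul_of_nonneg_left hJ (hsum t ht).le
  have hpot := sum_anhPot_le (dgcLevels T) (fun k t => f t (w t) - f t (x k t)) hr hjensen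
  have hblock : ∀ t, 1 ≤ t → t ≤ T →
      ∑ u ∈ Finset.Icc (dgcStart k t) t, (f u (w u) - f u (x k u))
        ≤ Real.sqrt (3 * cAOD T T) * Real.sqrt ((t : ℝ) - dgcStart k t + 1) := by
    intro t ht htT
    set C := ∑ u ∈ Finset.Icc (dgcStart k t) t, |f u (w u) - f u (x k u)| with hCdef
    have hC0 : 0 ≤ C := Finset.sum_nonneg fun _ _ => abs_nonneg _
    have hClen : C ≤ (t : ℝ) - dgcStart k t + 1 := by
      have h1 : C ≤ (Finset.Icc (dgcStart k t) t).card • (1 : ℝ) :=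
        Finset.sum_le_card_nsmul _ _ _ fun u hu =>
          hr k u ((one_le_dgcStart k t).trans (Finset.mem_Icc.1 hu).1)
      have h2 := dgcStart_le (k := k) ht
      rw [Nat.card_Icc, nsmul_eq_mul, mul_one, Nat.cast_sub (by omega)] at h1
      push_cast at h1
      linarith
    rw [← Real.sqrt_mul (by linarith [cAOD_nonneg hT])]
    have hexp : anhPot (∑ u ∈ Finset.Icc (dgcStart k t) t, (f u (w u) - f u (x k u))) C
        ≤ Real.exp (cAOD T T) := by
      refine le_trans ?_ (card_dgcLevels_mul_le_exp_cAOD hT)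
      refine le_trans ?_ ((hpot t ht).trans (by gcongr))
      exact Finset.single_le_sum (f := fun k =>
        anhPot (∑ u ∈ Finset.Icc (dgcStart k t) t, (f u (w u) - f u (x k u)))
          (∑ u ∈ Finset.Icc (dgcStart k t) t, |f u (w u) - f u (x k u)|))
        (fun _ _ => (Real.exp_pos _).le) ((hmem k).2 hk)
    refine (le_sqrt_of_anhPot_le (sum_le_sum_abs_self _ _) hC0 hexp).trans ?_
    have := cAOD_nonneg hT
    gcongr
  have hdiv := Nat.div_add_mod (T - 1) (2 ^ k)
  have hmod := Nat.mod_lt (T - 1) (Nat.two_pow_pos k)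
  rw [mul_comm] at hdiv
  refine (sum_le_of_block_bounds (Real.sqrt_nonneg _) hblock ((T - 1) / 2 ^ k) T (by omega)
    (by rw [add_mul]; omega) le_rfl).trans ?_
  have hle : (((T - 1) / 2 ^ k : ℕ) : ℝ) ≤ (T : ℝ) / 2 ^ k := by
    rw [le_div_iff₀ (by positivity)]
    exact_mod_cast (Nat.div_mul_le_self _ _).trans (Nat.sub_le T 1)
  rw [add_comm (1 : ℝ)]
  gcongr

/-- Lemma 4: under the AOD algorithm with horizon `T`, if the
path-length `P_T` of the comparator sequence `u` satisfies `D·2^{i−1} < P_T ≤ D·2^i`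
for some `1 ≤ i ≤ ⌈log₂ T⌉`, then the dynamic regret is at most
`(DG/2 + (3G/2)√(2DP_T) + √(3c(T)(1 + 2P_T/D)))·√T`. -/
theorem aod_dynamic_regret_middle
    (d T : ℕ) (hT : 1 ≤ T) (D G : ℝ)
    (Ω : Set (EuclideanSpace ℝ (Fin d)))
    (hne : Ω.Nonempty) (hcomp : IsCompact Ω) (hconv : Convex ℝ Ω)
    (hdiam : ∀ z ∈ Ω, ∀ z' ∈ Ω, ‖z - z'‖ ≤ D)
    (f : ℕ → EuclideanSpace ℝ (Fin d) → ℝ)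
    (hfconv : ∀ t, ConvexOn ℝ Set.univ (f t))
    (hfdiff : ∀ t z, DifferentiableAt ℝ (f t) z)
    (hgrad : ∀ t, ∀ z ∈ Ω, ‖gradient (f t) z‖ ≤ G)
    (hrange : ∀ t, ∀ z ∈ Ω, 0 ≤ f t z ∧ f t z ≤ 1)
    (proj : EuclideanSpace ℝ (Fin d) → EuclideanSpace ℝ (Fin d))
    (hproj : ∀ z, proj z ∈ Ω ∧ ∀ z' ∈ Ω, ‖proj z - z‖ ≤ ‖z' - z‖)
    (x : ℕ → ℕ → EuclideanSpace ℝ (Fin d))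
    (hx1 : ∀ k, x k 1 ∈ Ω)
    (hxup : ∀ k t, 1 ≤ t →
      x k (t + 1) = proj (x k t - (D / (G * Real.sqrt ((2 : ℝ) ^ k))) • gradient (f t) (x k t)))
    (w : ℕ → EuclideanSpace ℝ (Fin d))
    (hw : ∀ t, 1 ≤ t → w t = ∑ k ∈ dgcLevels T, aodWeight T f w x k t • x k t)
    (u : ℕ → EuclideanSpace ℝ (Fin d))
    (hu : ∀ t, 1 ≤ t → t ≤ T → u t ∈ Ω)
    (P : ℝ) (hP : P = ∑ t ∈ Finset.Ico 1 T, ‖u (t + 1) - u t‖)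
    (i : ℕ) (hi1 : 1 ≤ i) (hi2 : i ≤ Nat.clog 2 T)
    (hPlow : D * 2 ^ (i - 1) < P) (hPhigh : P ≤ D * 2 ^ i) :
    ∑ t ∈ Finset.Icc 1 T, f t (w t) - ∑ t ∈ Finset.Icc 1 T, f t (u t)
      ≤ (D * G / 2 + 3 * G / 2 * Real.sqrt (2 * D * P)
          + Real.sqrt (3 * cAOD T T * (1 + 2 * P / D))) * Real.sqrt (T : ℝ) := by
  obtain ⟨z₀, hz₀⟩ := hne
  have hD0 : 0 ≤ D := by simpa using hdiam z₀ hz₀ z₀ hz₀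
  have hG0 : 0 ≤ G := (norm_nonneg _).trans (hgrad 1 z₀ hz₀)
  have hT0 : (0 : ℝ) < T := by exact_mod_cast hT
  have hDP : D < P := by
    refine lt_of_le_of_lt (le_mul_of_one_le_right hD0 ?_) hPlow
    exact one_le_pow₀ one_le_two
  have hPT : P ≤ D * T := by
    have h : P ≤ (Finset.Ico 1 T).card • D := by
      rw [hP]
      refine Finset.sum_le_card_nsmul _ _ _ fun t ht => ?_
      obtain ⟨h1, h2⟩ := Finset.mem_Ico.1 ht
      exact hdiam _ (hu _ (by omega) (by omega)) _ (hu _ h1 h2.le)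
    rw [Nat.card_Ico, nsmul_eq_mul, Nat.cast_sub hT] at h
    push_cast at h
    nlinarith
  have hP0 : 0 < P := hD0.trans_lt hDP
  have hDpos : 0 < D := by
    rcases hD0.eq_or_lt with h | h
    · rw [← h, zero_mul] at hPT
      linarith
    · exact h
  obtain ⟨k, hk1, hk2⟩ := exists_nat_pow_near (x := T * D / P) (y := (2 : ℝ))
    (by rw [le_div_iff₀ hP0]; linarith) one_lt_two
  rw [le_div_iff₀ hP0] at hk1
  rw [div_lt_iff₀ hP0, pow_succ] at hk2
  have hN0 : (0 : ℝ) < 2 ^ k := by positivity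
  have hNT : (2 : ℝ) ^ k ≤ T := by
    have : (2 : ℝ) ^ k * D ≤ T * D := (mul_le_mul_of_nonneg_left hDP.le hN0.le).trans hk1
    exact le_of_mul_le_mul_right this hDpos
  have hx : ∀ k t, 1 ≤ t → x k t ∈ Ω := by
    intro k t ht
    induction t, ht using Nat.le_induction with
    | base => exact hx1 k
    | succ t ht _ => exact hxup k t ht ▸ (hproj _).1
  have hmeta : ∑ t ∈ Finset.Icc 1 T, (f t (w t) - f t (x k t))
      ≤ Real.sqrt (3 * cAOD T T * (1 + 2 * P / D)) * Real.sqrt T := by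
    refine (aod_regret_against_level hT hconv
      (fun t => (hfconv t).subset (Set.subset_univ _) hconv) hrange hx hw
      (by exact_mod_cast hNT)).trans ?_
    have hc := cAOD_nonneg hT
    rw [← Real.sqrt_mul (by positivity), ← Real.sqrt_mul (by positivity), mul_assoc (3 * _)]
    have hblocks : (T : ℝ) / 2 ^ k ≤ 2 * P / D := by
      rw [div_le_div_iff₀ hN0 hDpos]
      linarith
    gcongr
  have hogd : ∑ t ∈ Finset.Icc 1 T, (f t (x k t) - f t (u t))
      ≤ (D * G / 2 + 3 * G / 2 * Real.sqrt (2 * D * P)) * Real.sqrt T := by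
    rcases hG0.eq_or_lt with hG | hG
    · refine (Finset.sum_nonpos fun t ht => ?_).trans (by positivity)
      have ht1 := (Finset.mem_Icc.1 ht).1
      have h0 : gradient (f t) (x k t) = 0 :=
        norm_le_zero_iff.1 ((hgrad t _ (hx k t ht1)).trans hG.ge)
      simpa [h0] using sub_le_inner_gradient (hfconv t) (hfdiff t (x k t)) (u t)
    · have hs0 : 0 < Real.sqrt (2 ^ k) := Real.sqrt_pos.2 hN0
      have hs2 := Real.sq_sqrt hN0.le
      set s := Real.sqrt (2 ^ k) with hs
      have hη : 0 < D / (G * s) := by positivity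
      have h := ogd_dynamic_regret hconv hdiam hfconv hfdiff hgrad hproj (hx k)
        (hxup k) hη.le hu T hT le_rfl
      rw [← hP] at h
      set S := ∑ t ∈ Finset.Icc 1 T, (f t (x k t) - f t (u t))
      have hS : S ≤ D * G / 2 * s + P * G * s + D * G * T / (2 * s) := by
        have h' : 2 * (D / (G * s)) * S ≤ 2 * (D / (G * s))
            * (D * G / 2 * s + P * G * s + D * G * T / (2 * s)) := by
          have e : 2 * (D / (G * s)) * (D * G / 2 * s + P * G * s + D * G * T / (2 * s))
              = D ^ 2 + T * ((D / (G * s)) ^ 2 * G ^ 2) + 2 * D * P := by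
            field_simp
            ring
          rw [e]
          nlinarith [sq_nonneg ‖x k (T + 1) - u T‖]
        exact le_of_mul_le_mul_left h' (by positivity)
      have hsT : s ≤ Real.sqrt T := Real.sqrt_le_sqrt hNT
      obtain ⟨q, hq⟩ : ∃ q, q = Real.sqrt (2 * D * P) * Real.sqrt T := ⟨_, rfl⟩
      have hq0 : 0 ≤ q := hq ▸ by positivity
      have hq2 : q ^ 2 = 2 * (T * D) * P := by
        rw [hq, mul_pow, Real.sq_sqrt (by positivity), Real.sq_sqrt hT0.le]
        ring
      have hterm1 : P * s ≤ 3 / 4 * q := by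
        refine le_of_sq_le_sq ?_ (by positivity)
        rw [mul_pow, mul_pow, hq2, hs2]
        nlinarith
      have hterm2 : D * T / (2 * s) ≤ 3 / 4 * q := by
        rw [div_le_iff₀ (by positivity)]
        refine le_of_sq_le_sq ?_ (by positivity)
        have e : (3 / 4 * q * (2 * s)) ^ 2 = 9 / 4 * (2 ^ k * (2 * (T * D) * P)) := by
          rw [← hs2, ← hq2]
          ring
        rw [e, mul_pow]
        nlinarith [mul_pos hDpos hT0]
      have hterm : P * G * s + D * G * T / (2 * s) ≤ 3 * G / 2 * q := by
        calc P * G * s + D * G * T / (2 * s) = G * (P * s + D * T / (2 * s)) := by ring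
          _ ≤ G * (3 / 4 * q + 3 / 4 * q) := by gcongr
          _ = _ := by ring
      rw [add_mul, mul_assoc (3 * G / 2), ← hq]
      have : D * G / 2 * s ≤ D * G / 2 * Real.sqrt T := by gcongr
      linarith
  rw [add_mul]
  rw [Finset.sum_sub_distrib] at hmeta hogd
  linarith
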